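/- arXiv:2406.04757 — 2 statements merged into one kernel-verified Lean document; each statement's English description precedes it below -/
import Mathlib

section
/- Assume 1 ≤ k ≤ n(q-1), and write k-1 = r(q-1) + s with 0 ≤ s < q-1. Then the projective Reed-Muller code C_{n,k}^q has length N = (q^{n+1}-1)/(q-1), its dimension equals Σ_{t ≡ k (mod q-1), 0 < t ≤ k} Σ_{j=0}^{n+1} (-1)^j · C(n+1, j) · C(t - jq + n, t - jq), and its minimum distance equals (q-s)·q^{n-r-1}. -/
open scoped BigOperators

/-- A vector in `F^(n+1)` is a standard representative if its leftmost nonzero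
coordinate equals `1`. -/
def IsStdRep {F : Type*} [Field F] {n : ℕ} (v : Fin (n + 1) → F) : Prop :=
  ∃ i, (∀ j, j < i → v j = 0) ∧ v i = 1

/-- The set of standard affine representatives of the points of projective n-space. -/
abbrev ProjPts (F : Type*) [Field F] (n : ℕ) : Type _ :=
  {v : Fin (n + 1) → F // IsStdRep v}

noncomputable instance {F : Type*} [Field F] [Fintype F] {n : ℕ} :
    Fintype (ProjPts F n) := Fintype.ofFinite _

/-- Evaluation of a polynomial at the standard representatives, as a linear map. -/
noncomputable def evalOnPts (F : Type*) [Field F] [Fintype F] (n : ℕ) :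
    MvPolynomial (Fin (n + 1)) F →ₗ[F] (ProjPts F n → F) where
  toFun f := fun p => MvPolynomial.eval p.1 f
  map_add' f g := by ext p; simp
  map_smul' c f := by ext p; simp [MvPolynomial.smul_eval]

/-- The projective Reed–Muller code `C_{n,k}^q`: evaluations of homogeneous degree-`k`
polynomials at the standard representatives of the points of `ℙ^n(F)`. -/
noncomputable def PRM (F : Type*) [Field F] [Fintype F] (n k : ℕ) :
    Submodule F (ProjPts F n → F) :=
  Submodule.map (evalOnPts F n) (MvPolynomial.homogeneousSubmodule (Fin (n + 1)) F k)

/-- The dual code with respect to the standard bilinear form. -/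
noncomputable def dualCode {F : Type*} [Field F] [Fintype F] {n : ℕ}
    (C : Submodule F (ProjPts F n → F)) : Submodule F (ProjPts F n → F) where
  carrier := {y | ∀ c ∈ C, ∑ p : ProjPts F n, y p * c p = 0}
  zero_mem' := by intro c hc; simp
  add_mem' := by
    intro a b ha hb c hc
    show ∑ p : ProjPts F n, (a + b) p * c p = 0
    simp only [Pi.add_apply, add_mul, Finset.sum_add_distrib, ha c hc, hb c hc, add_zero]
  smul_mem' := by
    intro r a ha c hc
    show ∑ p : ProjPts F n, (r • a) p * c p = 0
    simp only [Pi.smul_apply, smul_eq_mul, mul_assoc, ← Finset.mul_sum, ha c hc, mul_zero]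

/-- Binomial coefficient `C(a,b)` for integers, taken to be `0` when `b < 0`. -/
def intBinom (a b : ℤ) : ℤ := if 0 ≤ b then (a.toNat.choose b.toNat : ℤ) else 0

open MvPolynomial Finset

section ReedMuller

/-- The minimum distance of the affine Reed–Muller code of order `ν` in `m` variables. -/
def affineMinDist (q : ℕ) : ℕ → ℕ → ℕ
  | 0, _ => 1
  | m + 1, ν => if q - 1 ≤ ν then affineMinDist q m (ν - (q - 1)) else (q - ν) * q ^ m

theorem affineMinDist_pos {q : ℕ} (hq : 2 ≤ q) (m ν : ℕ) : 0 < affineMinDist q m ν := by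
  induction m generalizing ν with
  | zero => simp [affineMinDist]
  | succ m ih =>
    rw [affineMinDist]
    split_ifs with h
    · exact ih _
    · have : 0 < q - ν := by omega
      positivity

theorem affineMinDist_eq {q : ℕ} {n r s : ℕ} (hr : r < n) (hs : s < q - 1) :
    affineMinDist q n (r * (q - 1) + s) = (q - s) * q ^ (n - r - 1) := by
  induction r generalizing n with
  | zero =>
    obtain ⟨m, rfl⟩ : ∃ m, n = m + 1 := ⟨n - 1, by omega⟩
    simp [affineMinDist, hs.not_ge]
  | succ r ih =>
    obtain ⟨m, rfl⟩ : ∃ m, n = m + 1 := ⟨n - 1, by omega⟩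
    have h1 : (r + 1) * (q - 1) + s = (r * (q - 1) + s) + (q - 1) := by ring
    rw [affineMinDist, h1, if_pos (Nat.le_add_left _ _), Nat.add_sub_cancel, ih (by omega)]
    congr 2
    omega

theorem affineMinDist_succ_le {q e ν : ℕ} (m : ℕ) (hq : 2 ≤ q) (he : e ≤ q - 1) (heν : e ≤ ν) :
    affineMinDist q (m + 1) ν ≤ (q - e) * affineMinDist q m (ν - e) := by
  induction m generalizing ν with
  | zero =>
    simp only [affineMinDist]
    rw [pow_zero, mul_one, mul_one]
    split_ifs <;> omega
  | succ m ih =>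
    rw [affineMinDist]
    split_ifs with h
    · by_cases h2 : q - 1 ≤ ν - e
      · rw [affineMinDist.eq_2 q (ν - e), if_pos h2, Nat.sub_right_comm]
        exact ih (by omega)
      · rw [affineMinDist, affineMinDist, if_neg (by omega), if_neg h2, ← mul_assoc]
        gcongr
        obtain ⟨x, hx⟩ : ∃ x, q - e = x + 1 := ⟨q - e - 1, by omega⟩
        obtain ⟨y, hy⟩ : ∃ y, q - (ν - e) = y + 1 := ⟨q - (ν - e) - 1, by omega⟩
        have h3 : q - (ν - (q - 1)) = x + y + 1 := by omega
        rw [h3, hx, hy]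
        nlinarith
    · rw [affineMinDist, if_neg (by omega), ← mul_assoc, pow_succ', ← mul_assoc]
      refine Nat.mul_le_mul_right _ ?_
      obtain ⟨x, rfl⟩ : ∃ x, ν = e + x := ⟨ν - e, by omega⟩
      obtain ⟨y, rfl⟩ : ∃ y, q = e + x + y := ⟨q - (e + x), by omega⟩
      have h3 : e + x + y - (e + x) = y := by omega
      have h4 : e + x + y - e = x + y := by omega
      have h5 : e + x + y - (e + x - e) = e + y := by omega
      rw [h3, h4, h5]
      nlinarith [Nat.zero_le (e * x)]

theorem card_filter_cons {F : Type*} [Fintype F] {m : ℕ} (P : (Fin (m + 1) → F) → Prop)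
    [DecidablePred P] :
    #{v | P v} = ∑ y : Fin m → F, #{x : F | P (Fin.cons x y)} := by
  simp only [card_filter]
  rw [← Fintype.sum_prod_type_right'
      (fun (x : F) (y : Fin m → F) => if P (Fin.cons x y) then 1 else 0),
    ← (Fin.consEquiv (fun _ => F)).sum_comp]
  rfl

/-- The least exponent defining the same power map on a field with `q` elements as `e`. -/
def redExp (q e : ℕ) : ℕ := if e = 0 then 0 else (e - 1) % (q - 1) + 1

theorem redExp_zero (q : ℕ) : redExp q 0 = 0 := rfl

theorem redExp_eq_zero {q e : ℕ} : redExp q e = 0 ↔ e = 0 := by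
  unfold redExp
  split_ifs <;> simp_all

theorem redExp_le_self (q e : ℕ) : redExp q e ≤ e := by
  unfold redExp
  split_ifs with h
  · exact Nat.zero_le _
  · have := Nat.mod_le (e - 1) (q - 1)
    omega

theorem redExp_le {q : ℕ} (hq : 2 ≤ q) (e : ℕ) : redExp q e ≤ q - 1 := by
  unfold redExp
  split_ifs with h
  · exact Nat.zero_le _
  · have := Nat.mod_lt (e - 1) (show 0 < q - 1 by omega)
    omega

theorem redExp_modEq (q e : ℕ) : redExp q e ≡ e [MOD q - 1] := by
  unfold redExp
  split_ifs with h
  · rw [h]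
  · conv_rhs => rw [← Nat.sub_add_cancel (Nat.pos_of_ne_zero h)]
    exact (Nat.mod_modEq _ _).add_right 1

theorem MvPolynomial.IsHomogeneous.eval_smul {σ R : Type*} [CommSemiring R]
    {p : MvPolynomial σ R} {k : ℕ} (hp : p.IsHomogeneous k) (c : R) (v : σ → R) :
    eval (c • v) p = c ^ k * eval v p := by
  rw [eval_eq, eval_eq, mul_sum]
  refine sum_congr rfl fun d hd => ?_
  have hdeg : ∑ i ∈ d.support, d i = k := hp.degree_eq_sum_deg_support hd ▸ rfl
  simp only [Pi.smul_apply, smul_eq_mul, mul_pow, prod_mul_distrib, prod_pow_eq_pow_sum, hdeg]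
  ring

variable {F : Type*} [Field F]

theorem exists_homogeneous_comp {m m' k : ℕ} {f : MvPolynomial (Fin m) F} (hf : f.IsHomogeneous k)
    (L : (Fin m' → F) →ₗ[F] (Fin m → F)) :
    ∃ g : MvPolynomial (Fin m') F, g.IsHomogeneous k ∧ ∀ v, eval v g = eval (L v) f := by
  refine ⟨aeval (fun i => ∑ j, C (L (Pi.single j 1) i) * X j) f, ?_, fun v => ?_⟩
  · have := hf.aeval (fun i => ∑ j, C (L (Pi.single j 1) i) * X j : Fin m → MvPolynomial (Fin m') F)
      (n := 1) (fun i => IsHomogeneous.sum _ _ _ fun j _ => isHomogeneous_C_mul_X _ _)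
    rwa [one_mul] at this
  · rw [← coe_aeval_eq_eval, RingHom.coe_coe, ← bind₁, aeval_bind₁, ← coe_aeval_eq_eval,
      RingHom.coe_coe]
    congr 2
    ext i
    rw [LinearMap.pi_apply_eq_sum_univ L v]
    have hs : ∀ x : Fin m', (Pi.single x 1 : Fin m' → F) = fun j => if x = j then 1 else 0 :=
      fun x => by ext j; simp [Pi.single_apply, eq_comm]
    simp [mul_comm, hs]

/-- Every nonzero linear form becomes the first coordinate in suitable coordinates. -/
theorem exists_linearEquiv_dotProduct {m : ℕ} {w : Fin (m + 1) → F} (hw : w ≠ 0) :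
    ∃ e : (Fin (m + 1) → F) ≃ₗ[F] (Fin (m + 1) → F), ∀ v, e v ⬝ᵥ w = v 0 := by
  obtain ⟨i, hi⟩ := Function.ne_iff.mp hw
  rw [Pi.zero_apply] at hi
  let φ : (Fin (m + 1) → F) →ₗ[F] (Fin (m + 1) → F) :=
    LinearMap.pi (Fin.cons ((dotProductBilin F F).flip w) fun j => LinearMap.proj (i.succAbove j))
  have hφ0 : ∀ u, φ u 0 = u ⬝ᵥ w := fun u => rfl
  have hφs : ∀ u j, φ u (Fin.succ j) = u (i.succAbove j) := fun u j => rfl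
  have hinj : Function.Injective φ := by
    rw [← LinearMap.ker_eq_bot, LinearMap.ker_eq_bot']
    intro u hu
    have hs : ∀ j, u (i.succAbove j) = 0 := fun j => (hφs u j).symm.trans (congrFun hu _)
    have h0 : u i * w i = 0 := by
      have : u ⬝ᵥ w = 0 := (hφ0 u).symm.trans (congrFun hu 0)
      rw [dotProduct, Fin.sum_univ_succAbove _ i] at this
      simpa [hs] using this
    ext j
    rcases Fin.eq_self_or_eq_succAbove i j with rfl | ⟨j, rfl⟩
    · simpa [hi] using h0
    · exact hs j
  refine ⟨(LinearEquiv.ofInjectiveEndo φ hinj).symm, fun v => ?_⟩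
  rw [← hφ0]
  exact congrFun ((LinearEquiv.ofInjectiveEndo φ hinj).apply_symm_apply v) 0

variable [Fintype F]

theorem pow_redExp (x : F) (e : ℕ) : x ^ redExp (Fintype.card F) e = x ^ e := by
  rcases eq_or_ne x 0 with rfl | hx
  · rcases eq_or_ne e 0 with rfl | he
    · rw [redExp_zero]
    · rw [zero_pow he, zero_pow (redExp_eq_zero.not.mpr he)]
  · exact pow_eq_pow_of_modEq (redExp_modEq _ e) (FiniteField.pow_card_sub_one_eq_one x hx)

theorem eval_monomial_mapRange_redExp {m : ℕ} (v : Fin m → F) (a : Fin m →₀ ℕ) (c : F) :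
    eval v (monomial (a.mapRange (redExp (Fintype.card F)) (redExp_zero _)) c) =
      eval v (monomial a c) := by
  simp only [eval_monomial, Finsupp.prod_pow, Finsupp.mapRange_apply, pow_redExp]

theorem exists_reduced {m : ℕ} (p : MvPolynomial (Fin m) F) :
    ∃ p' : MvPolynomial (Fin m) F, (∀ v, eval v p' = eval v p) ∧
      p'.totalDegree ≤ p.totalDegree ∧ ∀ i, p'.degreeOf i ≤ Fintype.card F - 1 := by
  refine ⟨∑ a ∈ p.support,
    monomial (a.mapRange (redExp (Fintype.card F)) (redExp_zero _)) (p.coeff a), ?_, ?_, ?_⟩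
  · intro v
    conv_rhs => rw [p.as_sum]
    simp only [map_sum, eval_monomial_mapRange_redExp]
  · refine (totalDegree_finsetSum _ _).trans (Finset.sup_le fun a ha => ?_)
    refine (totalDegree_monomial_le _ _).trans (le_trans ?_ (le_totalDegree ha))
    rw [Finsupp.sum_fintype _ _ (fun _ => rfl), Finsupp.sum_fintype _ _ (fun _ => rfl)]
    exact sum_le_sum fun i _ => redExp_le_self _ _
  · intro i
    refine (degreeOf_sum_le i _ _).trans (Finset.sup_le fun a ha => ?_)
    rw [degreeOf_monomial_eq _ _ (mem_support_iff.mp ha)]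
    exact redExp_le Fintype.one_lt_card _

theorem affineMinDist_le_card_of_degreeOf_le [DecidableEq F] {m ν : ℕ} {p : MvPolynomial (Fin m) F}
    (hp : p ≠ 0)
    (hν : p.totalDegree ≤ ν) (hred : ∀ i, p.degreeOf i ≤ Fintype.card F - 1) :
    affineMinDist (Fintype.card F) m ν ≤ #{v | eval v p ≠ 0} := by
  induction m generalizing ν with
  | zero =>
    rw [affineMinDist, Nat.one_le_iff_ne_zero, card_ne_zero]
    refine ⟨0, mem_filter.mpr ⟨mem_univ _, ?_⟩⟩
    rw [eq_C_of_isEmpty p] at hp ⊢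
    simpa using hp
  | succ m ih =>
    set P := finSuccEquiv F m p with hPdef
    have hP : P ≠ 0 := by simpa [P] using hp
    set e := P.natDegree with hedef
    have hlead : P.coeff e ≠ 0 := by simpa [e] using hP
    have he : e ≤ Fintype.card F - 1 := by
      rw [hedef, hPdef, natDegree_finSuccEquiv]
      exact hred 0
    have htd := totalDegree_coeff_finSuccEquiv_add_le p e hlead
    have heν : e ≤ ν := by omega
    have hq : 2 ≤ Fintype.card F := Fintype.one_lt_card
    have hcoef := ih hlead (ν := ν - e) (by rw [← hPdef] at htd; omega)
      (fun i => (degreeOf_coeff_finSuccEquiv p i e).trans (hred i.succ))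
    calc affineMinDist (Fintype.card F) (m + 1) ν
        ≤ (Fintype.card F - e) * affineMinDist (Fintype.card F) m (ν - e) :=
          affineMinDist_succ_le m hq he heν
      _ ≤ (Fintype.card F - e) * #{y | eval y (P.coeff e) ≠ 0} := by gcongr
      _ = ∑ y with eval y (P.coeff e) ≠ 0, (Fintype.card F - e) := by
          rw [sum_const, smul_eq_mul, mul_comm]
      _ ≤ ∑ y with eval y (P.coeff e) ≠ 0, #{x : F | eval (Fin.cons x y) p ≠ 0} := by
          refine sum_le_sum fun y hy => ?_
          have hy' : eval y (P.coeff e) ≠ 0 := (mem_filter.mp hy).2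
          have hmap : P.map (eval y) ≠ 0 := fun h => hy' (by
            rw [← Polynomial.coeff_map, h, Polynomial.coeff_zero])
          have hroots : #{x : F | eval (Fin.cons x y) p = 0} ≤ e := by
            calc #{x : F | eval (Fin.cons x y) p = 0} ≤ #(P.map (eval y)).roots.toFinset := by
                  refine card_le_card fun x hx => ?_
                  rw [Multiset.mem_toFinset, Polynomial.mem_roots hmap, Polynomial.IsRoot,
                    ← eval_eq_eval_mv_eval']
                  exact (mem_filter.mp hx).2
              _ ≤ (P.map (eval y)).roots.card := Multiset.toFinset_card_le _
              _ ≤ (P.map (eval y)).natDegree := Polynomial.card_roots' _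
              _ ≤ e := Polynomial.natDegree_map_le
          have := card_filter_add_card_filter_not (s := (univ : Finset F))
            (fun x : F => eval (Fin.cons x y) p = 0)
          rw [card_univ] at this
          simp only [ne_eq]
          omega
      _ ≤ ∑ y, #{x : F | eval (Fin.cons x y) p ≠ 0} :=
          sum_le_sum_of_subset (filter_subset _ _)
      _ = #{v | eval v p ≠ 0} := (card_filter_cons fun v => eval v p ≠ 0).symm

theorem eq_zero_of_reduced {m : ℕ} {p : MvPolynomial (Fin m) F} (hp : ∀ v, eval v p = 0)
    (hdeg : ∀ i, p.degreeOf i ≤ Fintype.card F - 1) : p = 0 := by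
  classical
  by_contra h
  have h1 := affineMinDist_le_card_of_degreeOf_le h le_rfl hdeg
  simp only [hp, ne_eq, not_true_eq_false, filter_false, card_empty] at h1
  exact (affineMinDist_pos Fintype.one_lt_card _ _).not_ge h1

/-- Inclusion–exclusion for the number of exponent vectors of a given degree with bounded
entries, read off from `(1 + X + ⋯ + X ^ (q - 1)) ^ (n + 1) = (1 - X ^ q) ^ (n + 1) /
(1 - X) ^ (n + 1)`. -/
theorem card_piFinset_range_sum_eq (q n t : ℕ) :
    (#{a ∈ Fintype.piFinset (fun _ : Fin (n + 1) => range q) | ∑ i, a i = t} : ℤ) =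
      ∑ j ∈ range (n + 2), (-1) ^ j * ((n + 1).choose j : ℤ) *
        intBinom ((t : ℤ) - j * q + n) ((t : ℤ) - j * q) := by
  have hpow : (∑ i ∈ range q, (PowerSeries.X : PowerSeries ℤ) ^ i) ^ (n + 1) =
      ∑ j ∈ range (n + 2), PowerSeries.C ((-1) ^ j * ((n + 1).choose j : ℤ)) *
        (PowerSeries.X ^ (j * q) * PowerSeries.mk fun i => ((n + i).choose n : ℤ)) := by
    calc (∑ i ∈ range q, (PowerSeries.X : PowerSeries ℤ) ^ i) ^ (n + 1)
        = ((∑ i ∈ range q, PowerSeries.X ^ i) * (1 - PowerSeries.X)) ^ (n + 1) *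
            PowerSeries.mk fun i => ((n + i).choose n : ℤ) := by
          rw [mul_pow, mul_assoc, mul_comm ((1 - PowerSeries.X) ^ (n + 1))]
          rw [PowerSeries.mk_add_choose_mul_one_sub_pow_eq_one ℤ n, mul_one]
      _ = (-PowerSeries.X ^ q + 1) ^ (n + 1) * PowerSeries.mk fun i => ((n + i).choose n : ℤ) := by
          rw [geom_sum_mul_neg, sub_eq_neg_add]
      _ = _ := by
          rw [add_pow, sum_mul]
          refine sum_congr rfl fun j _ => ?_
          rw [neg_pow, ← pow_mul, mul_comm q j, one_pow, mul_one]
          simp only [map_mul, map_pow, map_neg, map_one, map_natCast]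
          ring
  have hexp : (∑ i ∈ range q, (PowerSeries.X : PowerSeries ℤ) ^ i) ^ (n + 1) =
      ∑ a ∈ Fintype.piFinset (fun _ : Fin (n + 1) => range q), PowerSeries.X ^ ∑ i, a i := by
    have := prod_univ_sum (fun _ : Fin (n + 1) => range q)
      (fun _ i => (PowerSeries.X : PowerSeries ℤ) ^ i)
    rw [prod_const, card_univ, Fintype.card_fin] at this
    simp only [this, prod_pow_eq_pow_sum]
  have hcoeff := congrArg (PowerSeries.coeff t) (hexp.symm.trans hpow)
  simp only [map_sum, PowerSeries.coeff_X_pow, PowerSeries.coeff_C_mul,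
    PowerSeries.coeff_X_pow_mul', PowerSeries.coeff_mk] at hcoeff
  rw [card_filter, Nat.cast_sum]
  convert hcoeff using 2 with a _ j _
  · simp [eq_comm]
  · congr 1
    unfold intBinom
    have hiff : (0 : ℤ) ≤ (t : ℤ) - j * q ↔ j * q ≤ t := by
      rw [sub_nonneg]
      norm_cast
    simp only [hiff]
    split_ifs with h
    · have h1 : ((t : ℤ) - j * q) = ((t - j * q : ℕ) : ℤ) := by
        rw [Nat.cast_sub h, Nat.cast_mul]
      rw [h1, ← Nat.cast_add, Int.toNat_natCast, Int.toNat_natCast, Nat.add_comm n,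
        Nat.choose_symm_add]
    · rfl

/-- The exponents of the reduced monomials whose evaluations form a basis of the projective
Reed–Muller code. -/
def reducedExponents (q m k : ℕ) : Set (Fin m →₀ ℕ) :=
  {a | (∀ i, a i < q) ∧ 1 ≤ a.degree ∧ a.degree ≤ k ∧ a.degree ≡ k [MOD q - 1]}

theorem ncard_reducedExponents (q n k : ℕ) :
    (reducedExponents q (n + 1) k).ncard = ∑ t ∈ Icc 1 k, if t % (q - 1) = k % (q - 1) then
      #{a ∈ Fintype.piFinset (fun _ : Fin (n + 1) => range q) | ∑ i, a i = t} else 0 := by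
  have h1 : (reducedExponents q (n + 1) k).ncard = #{a ∈ Fintype.piFinset
      (fun _ : Fin (n + 1) => range q) | ∑ i, a i ∈ {t ∈ Icc 1 k | t % (q - 1) = k % (q - 1)}} := by
    rw [← Set.ncard_image_of_injective _
        (Finsupp.equivFunOnFinite (α := Fin (n + 1)) (M := ℕ)).injective,
      ← Set.ncard_coe_finset]
    congr 1
    ext a
    obtain ⟨a, rfl⟩ := Finsupp.equivFunOnFinite.surjective a
    rw [Finsupp.equivFunOnFinite.injective.mem_set_image]
    simp [reducedExponents, Finsupp.degree_eq_sum, Nat.ModEq, and_assoc]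
  rw [h1, ← sum_filter]
  refine (card_eq_sum_card_fiberwise (f := fun a : Fin (n + 1) → ℕ => ∑ i, a i)
    (t := {t ∈ Icc 1 k | t % (q - 1) = k % (q - 1)})
    fun a ha => (mem_filter.mp (mem_coe.mp ha)).2).trans (sum_congr rfl fun t ht => ?_)
  rw [filter_filter]
  congr 1
  refine filter_congr fun a _ => ?_
  refine ⟨fun h => h.2, fun h => ⟨?_, h⟩⟩
  subst h
  exact mem_coe.mpr ht

theorem map_restrictSupport_reducedExponents {n k : ℕ} (hk : 1 ≤ k) :
    (restrictSupport F (reducedExponents (Fintype.card F) (n + 1) k)).map (evalOnPts F n) =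
      PRM F n k := by
  have hq : 2 ≤ Fintype.card F := Fintype.one_lt_card
  have heq : ∀ a b : Fin (n + 1) →₀ ℕ,
      (∀ v : Fin (n + 1) → F, eval v (monomial a (1 : F)) = eval v (monomial b 1)) →
      evalOnPts F n (monomial a 1) = evalOnPts F n (monomial b 1) := fun a b h => by
    ext p
    exact h p.1
  rw [PRM, homogeneousSubmodule_eq_finsupp_supported]
  change _ = Submodule.map _ (restrictSupport F {d | d.degree = k})
  rw [restrictSupport_eq_span, restrictSupport_eq_span, Submodule.map_span, Submodule.map_span,
    Set.image_image, Set.image_image]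
  congr 1
  ext c
  constructor
  · rintro ⟨a, ⟨-, ha1, hak, hmod⟩, rfl⟩
    have hne : a ≠ 0 := by
      rintro rfl
      simp at ha1
    obtain ⟨i, hi⟩ := Finsupp.ne_iff.mp hne
    refine ⟨a + Finsupp.single i (k - a.degree), ?_, heq _ _ fun v => ?_⟩
    · rw [Set.mem_ofPred_eq, map_add, Finsupp.degree_single, Nat.add_sub_cancel' hak]
    · have hmod0 : k - a.degree ≡ 0 [MOD Fintype.card F - 1] :=
        ((Nat.modEq_iff_dvd' hak).mp hmod).modEq_zero_nat
      simp only [eval_monomial, one_mul, Finsupp.prod_pow]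
      refine prod_congr rfl fun j _ => ?_
      rw [Finsupp.add_apply]
      rcases eq_or_ne i j with rfl | hij
      · rw [Finsupp.single_eq_same]
        rcases eq_or_ne (v i) 0 with h0 | h0
        · rw [h0, zero_pow hi, zero_pow (by simp_all)]
        · exact pow_eq_pow_of_modEq (hmod0.add_left _) (FiniteField.pow_card_sub_one_eq_one _ h0)
      · simp [hij]
  · rintro ⟨a, ha, rfl⟩
    rw [Set.mem_ofPred_eq] at ha
    refine ⟨a.mapRange (redExp (Fintype.card F)) (redExp_zero _), ⟨fun i => ?_, ?_, ?_, ?_⟩,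
      heq _ _ fun v => eval_monomial_mapRange_redExp v a 1⟩
    · have := redExp_le hq (a i)
      rw [Finsupp.mapRange_apply]
      omega
    · rw [Nat.one_le_iff_ne_zero, Ne, Finsupp.degree_eq_zero_iff]
      intro h
      have : a = 0 := by
        ext i
        exact redExp_eq_zero.mp (DFunLike.congr_fun h i)
      rw [this, map_zero] at ha
      omega
    · rw [← ha, Finsupp.degree_eq_sum, Finsupp.degree_eq_sum]
      exact sum_le_sum fun i _ => redExp_le_self _ _
    · rw [← ha, Finsupp.degree_eq_sum, Finsupp.degree_eq_sum]
      exact Nat.ModEq.sum fun i _ => redExp_modEq _ _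

variable [DecidableEq F]

theorem affineMinDist_le_card {m ν : ℕ} {p : MvPolynomial (Fin m) F}
    (hp : ∃ v, eval v p ≠ 0) (hν : p.totalDegree ≤ ν) :
    affineMinDist (Fintype.card F) m ν ≤ #{v | eval v p ≠ 0} := by
  obtain ⟨p', heval, htd, hdeg⟩ := exists_reduced p
  obtain ⟨v, hv⟩ := hp
  simp only [← heval] at hv ⊢
  exact affineMinDist_le_card_of_degreeOf_le (fun h => hv (by rw [h, map_zero])) (htd.trans hν) hdeg

theorem MvPolynomial.IsHomogeneous.eval_zero {σ R : Type*} [CommSemiring R]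
    {p : MvPolynomial σ R} {k : ℕ} (hp : p.IsHomogeneous k) (hk : 1 ≤ k) : eval 0 p = 0 := by
  have := hp.eval_smul 0 0
  rwa [smul_zero, zero_pow (by omega), zero_mul] at this

theorem card_mul_le_card_of_cons_zero {n k : ℕ} {g : MvPolynomial (Fin (n + 1)) F}
    (hg : g.IsHomogeneous k) (hk : 1 ≤ k) (hne : ∃ v, eval v g ≠ 0)
    (hv : ∀ v, v 0 = 0 → eval v g = 0) :
    (Fintype.card F - 1) * affineMinDist (Fintype.card F) n (k - 1) ≤ #{v | eval v g ≠ 0} := by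
  set P := finSuccEquiv F n g with hP
  set p : MvPolynomial (Fin n) F := ∑ i ∈ range k, P.coeff (i + 1) with hp
  have hdeg : P.natDegree ≤ k := by
    rw [hP, natDegree_finSuccEquiv]
    exact (degreeOf_le_totalDegree _ _).trans hg.totalDegree_le
  have heval : ∀ y, eval y p = eval (Fin.cons 1 y) g := by
    intro y
    have h0 : eval y (P.coeff 0) = 0 := by
      have := hv (Fin.cons 0 y) (Fin.cons_zero _ _)
      rwa [eval_eq_eval_mv_eval', ← Polynomial.coeff_zero_eq_eval_zero,
        Polynomial.coeff_map] at this
    rw [eval_eq_eval_mv_eval', Polynomial.eval_eq_sum_range'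
      (Nat.lt_succ_of_le (Polynomial.natDegree_map_le.trans hdeg)), sum_range_succ', hp, map_sum]
    simp only [Polynomial.coeff_map, one_pow, mul_one]
    rw [h0, add_zero]
  have htd : p.totalDegree ≤ k - 1 := by
    refine (totalDegree_finsetSum _ _).trans (Finset.sup_le fun i hi => ?_)
    rw [mem_range] at hi
    have := (hg.finSuccEquiv_coeff_isHomogeneous (i + 1) (k - (i + 1)) (by omega)).totalDegree_le
    exact this.trans (by omega)
  have hpne : ∃ y, eval y p ≠ 0 := by
    obtain ⟨v, hvg⟩ := hne
    have hv0 : v 0 ≠ 0 := fun h => hvg (hv v h)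
    refine ⟨(v 0)⁻¹ • Fin.tail v, fun h => hvg ?_⟩
    have hcons : v = v 0 • (Fin.cons 1 ((v 0)⁻¹ • Fin.tail v) : Fin (n + 1) → F) := by
      ext j
      refine Fin.cases ?_ (fun j => ?_) j
      · simp
      · simp [Fin.tail, hv0]
    rw [hcons, hg.eval_smul, ← heval, h, mul_zero]
  calc (Fintype.card F - 1) * affineMinDist (Fintype.card F) n (k - 1)
      ≤ Fintype.card Fˣ * #{y | eval y p ≠ 0} := by
        rw [Fintype.card_units]
        exact Nat.mul_le_mul_left _ (affineMinDist_le_card hpne htd)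
    _ = #((univ : Finset Fˣ) ×ˢ ({y | eval y p ≠ 0} : Finset (Fin n → F))) := by
        rw [card_product, card_univ]
    _ ≤ #{v | eval v g ≠ 0} := by
        refine card_le_card_of_injOn
          (fun x => (x.1 : F) • (Fin.cons 1 x.2 : Fin (n + 1) → F)) ?_ ?_
        · rintro ⟨c, y⟩ hy
          have hy' : eval y p ≠ 0 := by simpa using hy
          rw [mem_coe, mem_filter]
          refine ⟨mem_univ _, ?_⟩
          rw [hg.eval_smul, ← heval]
          exact mul_ne_zero (pow_ne_zero _ c.ne_zero) hy'
        · rintro ⟨c, y⟩ - ⟨c', y'⟩ - h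
          have hc : c = c' := Units.ext (by simpa using congrFun h 0)
          subst hc
          simp only [Prod.mk.injEq, true_and]
          ext j
          simpa using congrFun h j.succ

theorem card_mul_le_card_of_hyperplane {n k : ℕ} {f : MvPolynomial (Fin (n + 1)) F}
    (hf : f.IsHomogeneous k) (hk : 1 ≤ k) (hne : ∃ v, eval v f ≠ 0) {w : Fin (n + 1) → F}
    (hw : w ≠ 0) (hv : ∀ v, v ⬝ᵥ w = 0 → eval v f = 0) :
    (Fintype.card F - 1) * affineMinDist (Fintype.card F) n (k - 1) ≤ #{v | eval v f ≠ 0} := by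
  obtain ⟨e, he⟩ := exists_linearEquiv_dotProduct hw
  obtain ⟨g, hg, hgf⟩ := exists_homogeneous_comp hf e.toLinearMap
  simp only [LinearEquiv.coe_coe] at hgf
  refine (card_mul_le_card_of_cons_zero hg hk ?_ ?_).trans (card_le_card_of_injOn e ?_ ?_)
  · obtain ⟨v, hvf⟩ := hne
    exact ⟨e.symm v, by rwa [hgf, e.apply_symm_apply]⟩
  · intro v h0
    rw [hgf]
    exact hv _ (by rw [he, h0])
  · intro v hvg
    simpa [hgf] using hvg
  · exact e.injective.injOn

theorem card_dotProduct_eq_zero_lt {n : ℕ} {v : Fin (n + 1) → F} (hv : v ≠ 0) :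
    #{w : Fin (n + 1) → F | w ≠ 0 ∧ v ⬝ᵥ w = 0} < Fintype.card F ^ n := by
  obtain ⟨e, he⟩ := exists_linearEquiv_dotProduct hv
  have hlt : #{w : Fin (n + 1) → F | w ≠ 0 ∧ v ⬝ᵥ w = 0} < #{w : Fin (n + 1) → F | v ⬝ᵥ w = 0} := by
    refine card_lt_card ⟨fun w hw => ?_, fun h => ?_⟩
    · exact mem_filter.mpr ⟨mem_univ _, (mem_filter.mp hw).2.2⟩
    · have := h (mem_filter.mpr ⟨mem_univ 0, dotProduct_zero v⟩)
      exact (mem_filter.mp this).2.1 rfl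
  refine hlt.trans_le ?_
  calc #{w : Fin (n + 1) → F | v ⬝ᵥ w = 0} ≤ #(univ : Finset (Fin n → F)) := by
        refine card_le_card_of_injOn (fun w => Fin.tail (e.symm w)) (fun _ _ => by simp) ?_
        intro w hw w' hw' h
        have h0 : ∀ w ∈ (({w | v ⬝ᵥ w = 0} : Finset (Fin (n + 1) → F)) : Set (Fin (n + 1) → F)),
            e.symm w 0 = 0 := by
          intro w hw
          rw [← he (e.symm w), e.apply_symm_apply, dotProduct_comm]
          simpa using hw
        apply e.symm.injective
        ext j
        refine Fin.cases ?_ (fun j => congrFun h j) j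
        rw [h0 w hw, h0 w' hw']
    _ = Fintype.card F ^ n := by simp

theorem card_mul_affineMinDist_le_card {n k : ℕ} {f : MvPolynomial (Fin (n + 1)) F}
    (hf : f.IsHomogeneous k) (hk : 1 ≤ k) (hne : ∃ v, eval v f ≠ 0) :
    (Fintype.card F - 1) * affineMinDist (Fintype.card F) n (k - 1) ≤ #{v | eval v f ≠ 0} := by
  induction n with
  | zero =>
    refine card_mul_le_card_of_hyperplane hf hk hne (w := 1) one_ne_zero fun v hv => ?_
    have : v = 0 := by
      ext j
      obtain rfl : j = 0 := Fin.fin_one_eq_zero j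
      simpa [dotProduct] using hv
    rw [this, hf.eval_zero hk]
  | succ n ih =>
    by_cases hH : ∃ w : Fin (n + 2) → F, w ≠ 0 ∧ ∀ v, v ⬝ᵥ w = 0 → eval v f = 0
    · obtain ⟨w, hw, hv⟩ := hH
      exact card_mul_le_card_of_hyperplane hf hk hne hw hv
    push Not at hH
    set q := Fintype.card F with hqdef
    have hq : 2 ≤ q := Fintype.one_lt_card
    set A := (q - 1) * affineMinDist q n (k - 1) with hA
    have hsection : ∀ w ∈ ({w | w ≠ 0} : Finset (Fin (n + 2) → F)),
        A ≤ #{v ∈ ({v | eval v f ≠ 0} : Finset (Fin (n + 2) → F)) | v ⬝ᵥ w = 0} := by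
      intro w hw
      have hw0 : w ≠ 0 := (mem_filter.mp hw).2
      obtain ⟨e, he⟩ := exists_linearEquiv_dotProduct hw0
      let ι : (Fin (n + 1) → F) →ₗ[F] (Fin (n + 2) → F) :=
        LinearMap.pi (Fin.cons 0 fun j => LinearMap.proj j)
      have hι0 : ∀ y, ι y 0 = 0 := fun y => rfl
      have hιs : ∀ y j, ι y (Fin.succ j) = y j := fun y j => rfl
      obtain ⟨g, hg, hgf⟩ := exists_homogeneous_comp hf (e.toLinearMap ∘ₗ ι)
      simp only [LinearMap.comp_apply, LinearEquiv.coe_coe] at hgf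
      refine (ih hg ?_).trans (card_le_card_of_injOn (fun y => e (ι y)) ?_ ?_)
      · obtain ⟨v, hv, hvf⟩ := hH w hw0
        refine ⟨Fin.tail (e.symm v), ?_⟩
        have : ι (Fin.tail (e.symm v)) = e.symm v := by
          ext j
          refine Fin.cases ?_ (fun j => rfl) j
          rw [hι0, ← he (e.symm v), e.apply_symm_apply, hv]
        rwa [hgf, this, e.apply_symm_apply]
      · intro y hy
        simpa [he, hι0, ← hgf] using hy
      · intro y _ y' _ h
        ext j
        rw [← hιs y, ← hιs y', e.injective h]
    have hdc : #{w : Fin (n + 2) → F | w ≠ 0} * A ≤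
        #{v | eval v f ≠ 0} * (q ^ (n + 1) - 1) := by
      calc #{w : Fin (n + 2) → F | w ≠ 0} * A
          ≤ ∑ w with w ≠ 0,
              #{v ∈ ({v | eval v f ≠ 0} : Finset (Fin (n + 2) → F)) | v ⬝ᵥ w = 0} :=
            card_nsmul_le_sum _ _ _ hsection
        _ = ∑ v with eval v f ≠ 0,
              #{w ∈ ({w | w ≠ 0} : Finset (Fin (n + 2) → F)) | v ⬝ᵥ w = 0} :=
            (sum_card_bipartiteAbove_eq_sum_card_bipartiteBelow fun v w => v ⬝ᵥ w = 0).symm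
        _ ≤ #{v | eval v f ≠ 0} * (q ^ (n + 1) - 1) := by
            refine sum_le_card_nsmul _ _ _ fun v hv => ?_
            have hv0 : v ≠ 0 := by
              rintro rfl
              exact (mem_filter.mp hv).2 (hf.eval_zero hk)
            rw [filter_filter]
            exact Nat.le_sub_one_of_lt (card_dotProduct_eq_zero_lt hv0)
    have hcard : #{w : Fin (n + 2) → F | w ≠ 0} = q * q ^ (n + 1) - 1 := by
      rw [filter_ne', card_erase_of_mem (mem_univ _), card_univ, Fintype.card_fun, Fintype.card_fin,
        pow_succ' q]
    have hpow : 1 < q ^ (n + 1) := Nat.one_lt_pow (by omega) hq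
    have hle := affineMinDist_succ_le (ν := k - 1) n hq (Nat.zero_le _) (Nat.zero_le _)
    rw [Nat.sub_zero, Nat.sub_zero] at hle
    calc (q - 1) * affineMinDist q (n + 1) (k - 1)
        ≤ (q - 1) * (q * affineMinDist q n (k - 1)) := Nat.mul_le_mul_left _ hle
      _ = q * A := by rw [hA]; ring
      _ ≤ #{v | eval v f ≠ 0} := by
        refine le_of_mul_le_mul_right (le_trans ?_ hdc) (Nat.sub_pos_of_lt hpow)
        rw [hcard, mul_right_comm]
        refine Nat.mul_le_mul_right _ ?_
        rw [Nat.mul_sub, mul_one]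
        omega

theorem card_filter_eq_card_projPts {n : ℕ} (P : (Fin (n + 1) → F) → Prop) [DecidablePred P]
    (h0 : ¬ P 0) (hP : ∀ (c : F) v, c ≠ 0 → (P (c • v) ↔ P v)) :
    #{v | P v} = (Fintype.card F - 1) * #{p : ProjPts F n | P p.1} := by
  rw [← Fintype.card_units, ← card_univ, ← card_product]
  refine (card_bij (fun x _ => (x.1 : F) • x.2.1) ?_ ?_ ?_).symm
  · rintro ⟨c, p⟩ hp
    simpa [hP _ _ c.ne_zero] using hp
  · have hle : ∀ (c c' : Fˣ) (v v' : Fin (n + 1) → F) (i i' : Fin (n + 1)), v i = 1 →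
        (∀ j < i', v' j = 0) → (c : F) • v = (c' : F) • v' → i' ≤ i := by
      intro c c' v v' i i' hi hi' h
      by_contra hlt
      have := congrFun h i
      simp [hi, hi' i (not_le.mp hlt)] at this
    rintro ⟨c, v, i, hi, hi1⟩ - ⟨c', v', i', hi', hi1'⟩ - h
    dsimp only at h
    obtain rfl : i = i' := le_antisymm
      (hle c' c v' v i' i hi1' hi h.symm) (hle c c' v v' i i' hi1 hi' h)
    obtain rfl : c = c' := Units.ext (by simpa [hi1, hi1'] using congrFun h i)
    have hv : v = v' := smul_right_injective _ c.ne_zero h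
    subst hv
    rfl
  · intro v hv
    have hv' : P v := (mem_filter.mp hv).2
    have hv0 : v ≠ 0 := by rintro rfl; exact h0 hv'
    obtain ⟨i, hi, hmin⟩ := WellFounded.has_min (wellFounded_lt (α := Fin (n + 1)))
      {i | v i ≠ 0} (Function.ne_iff.mp hv0)
    have hi0 : v i ≠ 0 := hi
    refine ⟨(Units.mk0 (v i) hi0, ⟨(v i)⁻¹ • v, i, fun j hj => ?_, ?_⟩), ?_, ?_⟩
    · have : v j = 0 := by
        by_contra h
        exact hmin j h hj
      simp [this]
    · simp [hi0]
    · simp [hP _ _ (inv_ne_zero hi0), hv']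
    · simp [smul_smul, hi0]

theorem card_projPts (n : ℕ) :
    Fintype.card (ProjPts F n) = (Fintype.card F ^ (n + 1) - 1) / (Fintype.card F - 1) := by
  have h := card_filter_eq_card_projPts (F := F) (n := n) (fun v => v ≠ 0) (by simp)
    (fun c v hc => by simp [hc])
  have huniv : ({p : ProjPts F n | p.1 ≠ 0} : Finset _) = univ := by
    refine filter_true_of_mem fun p _ h0 => ?_
    obtain ⟨i, -, hi⟩ := p.2
    rw [h0] at hi
    exact zero_ne_one hi
  rw [huniv, card_univ, filter_ne', card_erase_of_mem (mem_univ _), card_univ, Fintype.card_fun,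
    Fintype.card_fin] at h
  rw [h, Nat.mul_div_cancel_left _ (Nat.sub_pos_of_lt Fintype.one_lt_card)]

theorem card_eval_ne_zero_eq {n k : ℕ} {f : MvPolynomial (Fin (n + 1)) F}
    (hf : f.IsHomogeneous k) (hk : 1 ≤ k) :
    #{v | eval v f ≠ 0} = (Fintype.card F - 1) * hammingNorm (evalOnPts F n f) := by
  rw [card_filter_eq_card_projPts _ (by simpa using hf.eval_zero hk)]
  · rfl
  · intro c v hc
    rw [hf.eval_smul]
    simp [hc]

theorem affineMinDist_le_hammingNorm {n k : ℕ} (hk : 1 ≤ k) {c : ProjPts F n → F}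
    (hc : c ∈ PRM F n k) (hc0 : c ≠ 0) :
    affineMinDist (Fintype.card F) n (k - 1) ≤ hammingNorm c := by
  obtain ⟨f, hf, rfl⟩ := hc
  rw [SetLike.mem_coe, mem_homogeneousSubmodule] at hf
  obtain ⟨p, hp⟩ := Function.ne_iff.mp hc0
  have := card_mul_affineMinDist_le_card hf hk ⟨p.1, hp⟩
  rw [card_eval_ne_zero_eq hf hk] at this
  exact le_of_mul_le_mul_left this (Nat.sub_pos_of_lt Fintype.one_lt_card)

/-- A word of minimum weight: a product of linear forms whose nonzeros have first `r`
affine coordinates zero and the next one outside of a set of `s` elements. -/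
theorem exists_hammingNorm_eq {n r s : ℕ} (hr : r < n) (hs : s < Fintype.card F - 1) :
    ∃ c ∈ PRM F n (r * (Fintype.card F - 1) + s + 1),
      hammingNorm c = (Fintype.card F - s) * Fintype.card F ^ (n - r - 1) := by
  set q := Fintype.card F with hq
  have hq2 : 2 ≤ q := Fintype.one_lt_card
  obtain ⟨m, rfl⟩ : ∃ m, n = r + 1 + m := ⟨n - (r + 1), by omega⟩
  obtain ⟨S, -, hS⟩ := exists_subset_card_eq (s := (univ : Finset F)) (n := s)
    (by rw [card_univ]; omega)
  let σ : Fin (r + 1) → Fin (r + 1 + m + 1) := fun i => (Fin.castAdd m i).succ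
  let f : MvPolynomial (Fin (r + 1 + m + 1)) F :=
    (∏ i : Fin r, (X 0 ^ (q - 1) - X (σ i.castSucc) ^ (q - 1))) *
      (∏ a ∈ S, (X (σ (Fin.last r)) - C a * X 0)) * X 0
  have hf : f.IsHomogeneous (r * (q - 1) + s + 1) := by
    refine ((IsHomogeneous.mul ?_ ?_).mul (isHomogeneous_X _ _))
    · have := IsHomogeneous.prod (univ : Finset (Fin r))
        (fun i => (X 0 ^ (q - 1) - X (σ i.castSucc) ^ (q - 1) : MvPolynomial _ F)) (fun _ => q - 1)
        (fun i _ => (isHomogeneous_X_pow _ _).sub (isHomogeneous_X_pow _ _))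
      simpa using this
    · have := IsHomogeneous.prod S
        (fun a => (X (σ (Fin.last r)) - C a * X 0 : MvPolynomial _ F)) (fun _ => 1)
        (fun a _ => (isHomogeneous_X _ _).sub (isHomogeneous_C_mul_X _ _))
      simpa [hS] using this
  have hf0 : ∀ v, v 0 = 0 → eval v f = 0 := fun v hv => by simp [f, hv]
  have hf1 : ∀ y : Fin (r + 1 + m) → F, eval (Fin.cons 1 y) f ≠ 0 ↔
      (∀ i : Fin r, y (Fin.castAdd m i.castSucc) = 0) ∧ y (Fin.castAdd m (Fin.last r)) ∉ S := by
    intro y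
    have h1 : ∀ x : F, 1 - x ^ (q - 1) ≠ 0 ↔ x = 0 := by
      intro x
      rcases eq_or_ne x 0 with rfl | hx
      · simp [zero_pow (show q - 1 ≠ 0 by omega)]
      · simp [hx, hq, FiniteField.pow_card_sub_one_eq_one x hx]
    have h2 : ∀ x : F, ∏ a ∈ S, (x - a) ≠ 0 ↔ x ∉ S := by
      intro x
      rw [prod_ne_zero_iff]
      exact ⟨fun h hx => h x hx (sub_self x), fun h a ha hxa => h (sub_eq_zero.mp hxa ▸ ha)⟩
    have : eval (Fin.cons 1 y) f = (∏ i : Fin r, (1 - y (Fin.castAdd m i.castSucc) ^ (q - 1))) *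
        ∏ a ∈ S, (y (Fin.castAdd m (Fin.last r)) - a) := by
      simp [f, σ, map_prod]
    rw [this, mul_ne_zero_iff, h2, prod_ne_zero_iff]
    simp [h1]
  refine ⟨evalOnPts F _ f, ⟨f, hf, rfl⟩, ?_⟩
  let ψ : F × (Fin m → F) → (Fin (r + 1 + m) → F) := fun x =>
    Fin.append (Fin.snoc (fun _ => 0) x.1) x.2
  have hψ : ∀ y : Fin (r + 1 + m) → F, (∀ i : Fin r, y (Fin.castAdd m i.castSucc) = 0) →
      ψ (y (Fin.castAdd m (Fin.last r)), fun j => y (Fin.natAdd (r + 1) j)) = y := by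
    intro y hy
    ext j
    refine Fin.addCases (fun j => ?_) (fun j => ?_) j
    · refine Fin.lastCases ?_ (fun j => ?_) j
      · simp [ψ]
      · simp [ψ, hy]
    · simp [ψ]
  calc hammingNorm (evalOnPts F _ f) = #(Sᶜ ×ˢ (univ : Finset (Fin m → F))) := by
        refine (card_bij (fun x _ => ⟨Fin.cons 1 (ψ x), 0, by simp, by simp⟩) ?_ ?_ ?_).symm
        · rintro ⟨x, z⟩ hx
          have hx : x ∉ S := by simpa using hx
          refine mem_filter.mpr ⟨mem_univ _, (hf1 _).mpr ⟨fun i => ?_, ?_⟩⟩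
          · simp [ψ]
          · simpa [ψ] using hx
        · rintro ⟨x, z⟩ - ⟨x', z'⟩ - h
          have h' : ψ (x, z) = ψ (x', z') := by
            have h'' : (Fin.cons 1 (ψ (x, z)) : Fin (r + 1 + m + 1) → F) =
                Fin.cons 1 (ψ (x', z')) :=
              Subtype.ext_iff.mp h
            exact (Fin.cons_injective2 h'').2
          refine Prod.ext ?_ (funext fun j => ?_)
          · simpa [ψ] using congrFun h' (Fin.castAdd m (Fin.last r))
          · simpa [ψ] using congrFun h' (Fin.natAdd (r + 1) j)
        · rintro ⟨v, i, hi, hi1⟩ hv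
          have hv' : eval v f ≠ 0 := (mem_filter.mp hv).2
          clear hv
          obtain rfl : i = 0 := by
            by_contra h
            exact hv' (hf0 v (hi 0 (Fin.pos_of_ne_zero h)))
          obtain ⟨y, rfl⟩ : ∃ y : Fin (r + 1 + m) → F, v = Fin.cons 1 y :=
            ⟨Fin.tail v, by rw [← hi1, Fin.cons_self_tail]⟩
          obtain ⟨hy, hyS⟩ := (hf1 y).mp hv'
          exact ⟨(_, _), by simpa using hyS, Subtype.ext (by dsimp only; rw [hψ y hy])⟩
    _ = (q - s) * q ^ (r + 1 + m - r - 1) := by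
        rw [card_product, card_compl, hS, card_univ, Fintype.card_fun, Fintype.card_fin,
          show r + 1 + m - r - 1 = m by omega]

theorem isLeast_hammingNorm_PRM {n r s : ℕ} (hr : r < n) (hs : s < Fintype.card F - 1) :
    IsLeast {w : ℕ | ∃ c ∈ PRM F n (r * (Fintype.card F - 1) + s + 1), c ≠ 0 ∧ hammingNorm c = w}
      ((Fintype.card F - s) * Fintype.card F ^ (n - r - 1)) := by
  constructor
  · obtain ⟨c, hc, hw⟩ := exists_hammingNorm_eq hr hs
    refine ⟨c, hc, ?_, hw⟩
    rw [← hammingNorm_ne_zero_iff, hw]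
    exact mul_ne_zero (by omega) (pow_ne_zero _ Fintype.card_ne_zero)
  · rintro w ⟨c, hc, hc0, rfl⟩
    have := affineMinDist_le_hammingNorm (Nat.le_add_left _ _) hc hc0
    rwa [Nat.add_sub_cancel, affineMinDist_eq hr hs] at this

theorem eq_zero_of_mem_restrictSupport_reducedExponents {n k : ℕ} {f : MvPolynomial (Fin (n + 1)) F}
    (hf : f ∈ restrictSupport F (reducedExponents (Fintype.card F) (n + 1) k))
    (h : evalOnPts F n f = 0) : f = 0 := by
  rw [mem_restrictSupport_iff] at hf
  have hscale : ∀ (c : F) (v : Fin (n + 1) → F), c ≠ 0 → eval (c • v) f = c ^ k * eval v f := by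
    intro c v hc
    rw [eval_eq, eval_eq, mul_sum]
    refine sum_congr rfl fun d hd => ?_
    rw [← pow_eq_pow_of_modEq (hf hd).2.2.2 (FiniteField.pow_card_sub_one_eq_one _ hc),
      Finsupp.degree_apply]
    simp only [Pi.smul_apply, smul_eq_mul, mul_pow, prod_mul_distrib, prod_pow_eq_pow_sum]
    ring
  have hzero : eval 0 f = 0 := by
    rw [eval_eq]
    refine sum_eq_zero fun d hd => ?_
    have hne : d.support.Nonempty := by
      rw [Finsupp.support_nonempty_iff]
      rintro rfl
      simpa using (hf hd).2.1
    obtain ⟨i, hi⟩ := hne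
    rw [prod_eq_zero hi (zero_pow (Finsupp.mem_support_iff.mp hi)), mul_zero]
  have hall : #{v | eval v f ≠ 0} = 0 := by
    rw [card_filter_eq_card_projPts _ (by simpa using hzero) (fun c v hc => by
      rw [hscale c v hc]; simp [hc]), filter_false_of_mem, card_empty, mul_zero]
    exact fun p _ hp => hp (congrFun h p)
  refine eq_zero_of_reduced (fun v => ?_) fun i => ?_
  · by_contra hv
    exact (card_ne_zero_of_mem (mem_filter.mpr ⟨mem_univ v, hv⟩)) hall
  · rw [degreeOf_eq_sup]
    exact Finset.sup_le fun d hd => Nat.le_sub_one_of_lt ((hf hd).1 i)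

theorem finrank_PRM {n k : ℕ} (hk : 1 ≤ k) :
    Module.finrank F (PRM F n k) = (reducedExponents (Fintype.card F) (n + 1) k).ncard := by
  rw [← map_restrictSupport_reducedExponents hk, ← LinearMap.range_domRestrict,
    LinearMap.finrank_range_of_inj,
    Module.finrank_eq_nat_card_basis (basisRestrictSupport F _), Nat.card_coe_set_eq]
  rw [← LinearMap.ker_eq_bot, LinearMap.ker_eq_bot']
  exact fun f hf => Subtype.ext (eq_zero_of_mem_restrictSupport_reducedExponents f.2 hf)

end ReedMuller

theorem stmt1 (q n : ℕ) (F : Type*) [Field F] [Fintype F] [DecidableEq F]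
    (hq : Fintype.card F = q) (hn : 1 ≤ n) (k r s : ℕ) (hk1 : 1 ≤ k) (hk2 : k ≤ n * (q - 1))
    (hrs : k - 1 = r * (q - 1) + s) (hs : s < q - 1) :
    Fintype.card (ProjPts F n) = (q ^ (n + 1) - 1) / (q - 1) ∧
    (Module.finrank F (PRM F n k) : ℤ) =
      ∑ t ∈ Finset.Icc 1 k, (if t % (q - 1) = k % (q - 1) then
        ∑ j ∈ Finset.range (n + 2),
          (-1) ^ j * ((n + 1).choose j : ℤ) *
            intBinom ((t : ℤ) - j * q + n) ((t : ℤ) - j * q)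
      else 0) ∧
    IsLeast {w : ℕ | ∃ c ∈ PRM F n k, c ≠ 0 ∧ hammingNorm c = w}
      ((q - s) * q ^ (n - r - 1)) := by
  subst hq
  have hr : r < n := by
    by_contra h
    have := Nat.mul_le_mul_right (Fintype.card F - 1) (not_lt.mp h)
    omega
  refine ⟨card_projPts n, ?_, ?_⟩
  · rw [finrank_PRM hk1, ncard_reducedExponents]
    push_cast
    simp only [card_piFinset_range_sum_eq]
  · obtain rfl : k = r * (Fintype.card F - 1) + s + 1 := by omega
    exact isLeast_hammingNorm_PRM hr hs
end

section
/- Let k be an integer with 1 ≤ k ≤ n(q-1). Then the projective Reed-Muller code C_{n,k}^q is self-orthogonal if and only if 1 ≤ k ≤ n(q-1)/2 and 2k ≡ 0 (mod q-1). -/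
open scoped BigOperators

/-- Every nonzero vector is a nonzero scalar multiple of a standard representative. -/
theorem exists_unit_smul_stdRep {F : Type*} [Field F] {n : ℕ} (v : Fin (n + 1) → F)
    (hv : v ≠ 0) : ∃ (p : ProjPts F n) (u : Fˣ), (u : F) • p.1 = v := by
  obtain ⟨i, hi, hmin⟩ := WellFounded.has_min (wellFounded_lt (α := Fin (n + 1)))
    {i | v i ≠ 0} (Function.ne_iff.mp hv)
  refine ⟨⟨(v i)⁻¹ • v, i, fun j hj => ?_, inv_mul_cancel₀ hi⟩, Units.mk0 (v i) hi, ?_⟩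
  · have : v j = 0 := by_contra fun h => hmin j h hj
    simp [this]
  · rw [Units.val_mk0, smul_inv_smul₀ hi]

theorem unit_smul_stdRep_injective {F : Type*} [Field F] {n : ℕ} :
    Function.Injective (fun x : ProjPts F n × Fˣ => (x.2 : F) • x.1.1) := by
  rintro ⟨⟨p, i, hi, hi1⟩, u⟩ ⟨⟨p', j, hj, hj1⟩, u'⟩ h
  replace h (l) : (u : F) * p l = u' * p' l := congrFun h l
  obtain rfl : i = j := by
    rcases lt_trichotomy i j with hij | hij | hij
    · have := h i
      simp [hi1, hj i hij] at this
    · exact hij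
    · have := h j
      simp [hj1, hi j hij, eq_comm (a := (0 : F))] at this
  obtain rfl : u = u' := Units.ext (by simpa [hi1, hj1] using h i)
  obtain rfl : p = p' := funext fun l => mul_left_cancel₀ u.ne_zero (h l)
  rfl

theorem stdRep_ne_zero {F : Type*} [Field F] {n : ℕ} (p : ProjPts F n) : p.1 ≠ 0 := by
  obtain ⟨p, i, -, hi⟩ := p
  rintro rfl
  simp at hi

theorem natCast_card_sub_one {F : Type*} [Field F] [Fintype F] :
    ((Fintype.card F - 1 : ℕ) : F) = -1 := by
  rw [Nat.cast_sub Fintype.card_pos, FiniteField.cast_card_eq_zero]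
  simp

theorem MvPolynomial.IsHomogeneous.eval_smul_s9 {R σ : Type*} [CommSemiring R] [Fintype σ] {d : ℕ}
    {f : MvPolynomial σ R} (hf : f.IsHomogeneous d) (c : R) (v : σ → R) :
    MvPolynomial.eval (c • v) f = c ^ d * MvPolynomial.eval v f := by
  rw [MvPolynomial.eval_eq', MvPolynomial.eval_eq', Finset.mul_sum]
  refine Finset.sum_congr rfl fun e he => ?_
  have hed : ∑ i, e i = d := by
    rw [← Finsupp.degree_eq_sum]
    exact by_contra fun h => MvPolynomial.mem_support_iff.mp he (hf.coeff_eq_zero h)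
  simp only [Pi.smul_apply, smul_eq_mul, mul_pow, Finset.prod_mul_distrib,
    Finset.prod_pow_eq_pow_sum, hed]
  ring

/-- When `q - 1` divides the degree, summing a form over projective space is the same, up to
sign, as summing it over affine space. -/
theorem sum_eval_stdRep {F : Type*} [Field F] [Fintype F] [DecidableEq F] {n d : ℕ}
    (hd : d ≠ 0) (hdvd : Fintype.card F - 1 ∣ d) {h : MvPolynomial (Fin (n + 1)) F}
    (hh : h.IsHomogeneous d) :
    ∑ v : Fin (n + 1) → F, MvPolynomial.eval v h
      = -∑ p : ProjPts F n, MvPolynomial.eval p.1 h := by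
  have hsmul (p : Fin (n + 1) → F) (u : Fˣ) :
      MvPolynomial.eval ((u : F) • p) h = MvPolynomial.eval p h := by
    obtain ⟨m, rfl⟩ := hdvd
    have hu : (u : F) ^ ((Fintype.card F - 1) * m) = 1 := by
      rw [pow_mul, FiniteField.pow_card_sub_one_eq_one _ u.ne_zero, one_pow]
    rw [hh.eval_smul_s9, hu, one_mul]
  have h0 : MvPolynomial.eval (0 : Fin (n + 1) → F) h = 0 := by
    have := hh.eval_smul_s9 0 0
    simpa [hd] using this
  have hne : ∑ x : ProjPts F n × Fˣ, MvPolynomial.eval ((x.2 : F) • x.1.1) h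
      = ∑ v ∈ Finset.univ.erase (0 : Fin (n + 1) → F), MvPolynomial.eval v h := by
    refine Finset.sum_bij (fun x _ => (x.2 : F) • x.1.1) ?_ ?_ ?_ ?_
    · intro x _
      simpa using stdRep_ne_zero x.1
    · intro x _ y _ hxy
      exact unit_smul_stdRep_injective hxy
    · intro v hv
      obtain ⟨p, u, rfl⟩ := exists_unit_smul_stdRep v (Finset.ne_of_mem_erase hv)
      exact ⟨(p, u), Finset.mem_univ _, rfl⟩
    · intros
      rfl
  rw [← Finset.add_sum_erase _ _ (Finset.mem_univ 0), h0, zero_add, ← hne, Fintype.sum_prod_type]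
  simp only [hsmul, Finset.sum_const, Finset.card_univ, Fintype.card_units, nsmul_eq_mul,
    natCast_card_sub_one, neg_one_mul, Finset.sum_neg_distrib]

theorem sum_pow_eq_neg_one {F : Type*} [Field F] [Fintype F] {e : ℕ} (he : e ≠ 0)
    (hdvd : Fintype.card F - 1 ∣ e) : ∑ x : F, x ^ e = -1 := by
  classical
  obtain ⟨m, rfl⟩ := hdvd
  have hx : ∀ x ∈ Finset.univ.erase (0 : F), x ^ ((Fintype.card F - 1) * m) = 1 := fun x hx => by
    rw [pow_mul, FiniteField.pow_card_sub_one_eq_one _ (Finset.ne_of_mem_erase hx), one_pow]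
  rw [← Finset.add_sum_erase _ _ (Finset.mem_univ 0), zero_pow he, zero_add,
    Finset.sum_congr rfl hx]
  simp [natCast_card_sub_one]

theorem PRM_le_dualCode_iff {F : Type*} [Field F] [Fintype F] {n k : ℕ} :
    PRM F n k ≤ dualCode (PRM F n k) ↔
      ∀ f g : MvPolynomial (Fin (n + 1)) F, f.IsHomogeneous k → g.IsHomogeneous k →
        ∑ p : ProjPts F n, MvPolynomial.eval p.1 (f * g) = 0 := by
  constructor
  · intro h f g hf hg
    simpa [evalOnPts] using h ⟨f, hf, rfl⟩ _ ⟨g, hg, rfl⟩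
  · rintro h _ ⟨f, hf, rfl⟩ _ ⟨g, hg, rfl⟩
    simpa [evalOnPts] using h f g hf hg

/-- The last coordinate power sum is `1` unless `q - 1` divides the exponent: scaling the last
coordinate permutes all points but `(0 : ⋯ : 0 : 1)`. -/
theorem sum_last_pow_stdRep {F : Type*} [Field F] [Fintype F] [DecidableEq F] {n d : ℕ}
    (hdvd : ¬ Fintype.card F - 1 ∣ d) :
    ∑ p : ProjPts F n, p.1 (Fin.last n) ^ d = 1 := by
  obtain ⟨u, hu⟩ := IsCyclic.exists_generator (α := Fˣ)
  have hud : (u : F) ^ d ≠ 1 := fun h => hdvd <| by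
    rw [← Fintype.card_units, ← Nat.card_eq_fintype_card, ← orderOf_eq_card_of_forall_mem_zpowers hu]
    exact orderOf_dvd_of_pow_eq_one (Units.ext (by simpa using h))
  let o : ProjPts F n := ⟨Pi.single (Fin.last n) 1, Fin.last n,
    fun j hj => by simp [hj.ne], by simp⟩
  have hstd (c : F) (p : ProjPts F n) (hp : p ≠ o) :
      IsStdRep (Function.update p.1 (Fin.last n) (c * p.1 (Fin.last n))) := by
    obtain ⟨p, i, hi, hi1⟩ := p
    have hin : i ≠ Fin.last n := by
      rintro rfl
      refine hp (Subtype.ext (funext fun j => ?_))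
      rcases (Fin.le_last j).eq_or_lt with rfl | hj
      · simp [o, hi1]
      · simp [o, hj.ne, hi j hj]
    refine ⟨i, fun j hj => ?_, by simp [hin, hi1]⟩
    rw [Function.update_of_ne (hj.trans_le (Fin.le_last i)).ne]
    exact hi j hj
  have hscale_ne (c : F) (p : ProjPts F n) (hp : p ≠ o) :
      (⟨_, hstd c p hp⟩ : ProjPts F n) ≠ o := by
    intro h
    have h (j) : Function.update p.1 (Fin.last n) (c * p.1 (Fin.last n)) j = o.1 j :=
      congrFun (congrArg Subtype.val h) j
    obtain ⟨i, hi, hi1⟩ := p.2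
    by_cases hin : i = Fin.last n
    · subst hin
      refine hp (Subtype.ext (funext fun j => ?_))
      rcases (Fin.le_last j).eq_or_lt with rfl | hj
      · simp [o, hi1]
      · simp [o, hj.ne, hi j hj]
    · have := h i
      simp [o, hin, hi1] at this
  have hsum : ∑ p ∈ Finset.univ.erase o, p.1 (Fin.last n) ^ d
      = ∑ p ∈ Finset.univ.erase o, (u : F) ^ d * p.1 (Fin.last n) ^ d := by
    symm
    refine Finset.sum_bij'
      (fun p hp => ⟨_, hstd u p (Finset.ne_of_mem_erase hp)⟩)
      (fun p hp => ⟨_, hstd (u : F)⁻¹ p (Finset.ne_of_mem_erase hp)⟩) ?_ ?_ ?_ ?_ ?_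
    · intro p hp
      exact Finset.mem_erase.mpr ⟨hscale_ne _ p (Finset.ne_of_mem_erase hp), Finset.mem_univ _⟩
    · intro p hp
      exact Finset.mem_erase.mpr ⟨hscale_ne _ p (Finset.ne_of_mem_erase hp), Finset.mem_univ _⟩
    · intro p hp
      simp
    · intro p hp
      simp
    · intro p hp
      simp [mul_pow]
  rw [← Finset.mul_sum] at hsum
  have hzero : ∑ p ∈ Finset.univ.erase o, p.1 (Fin.last n) ^ d = 0 := by
    by_contra hne
    exact hud (mul_right_cancel₀ hne (hsum.symm.trans (one_mul _).symm))
  rw [← Finset.add_sum_erase _ _ (Finset.mem_univ o), hzero]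
  simp [o]

theorem stmt9 (q n : ℕ) (F : Type*) [Field F] [Fintype F] [DecidableEq F]
    (hq : Fintype.card F = q) (hn : 1 ≤ n) (k : ℕ) (hk1 : 1 ≤ k) (hk2 : k ≤ n * (q - 1)) :
    PRM F n k ≤ dualCode (PRM F n k) ↔ 2 * k ≤ n * (q - 1) ∧ (q - 1) ∣ 2 * k := by
  subst hq
  have hq1 : 0 < Fintype.card F - 1 := Nat.sub_pos_of_lt Fintype.one_lt_card
  rw [PRM_le_dualCode_iff]
  constructor
  · intro h
    have hdvd : Fintype.card F - 1 ∣ 2 * k := by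
      by_contra hdvd
      have hX := MvPolynomial.isHomogeneous_X_pow (R := F) (Fin.last n) k
      have := h _ _ hX hX
      simp only [← pow_add, ← two_mul, map_pow, MvPolynomial.eval_X] at this
      exact one_ne_zero ((sum_last_pow_stdRep hdvd).symm.trans this)
    refine ⟨?_, hdvd⟩
    by_contra! hlt
    obtain ⟨m, hm⟩ := hdvd
    have hnm : n < m := by
      rw [hm, mul_comm] at hlt
      exact lt_of_mul_lt_mul_left hlt hq1.le
    let e : Fin (n + 1) →₀ ℕ := Finsupp.equivFunOnFinite.symm
      (Fin.cons ((Fintype.card F - 1) * (m - n)) fun _ => Fintype.card F - 1)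
    have hdeg : e.degree = 2 * k := by
      rw [Finsupp.degree_eq_sum, Fin.sum_univ_succ, hm]
      obtain ⟨l, rfl⟩ := Nat.exists_eq_add_of_lt hnm
      simp only [e, Finsupp.equivFunOnFinite_symm_apply_apply, Fin.cons_zero, Fin.cons_succ,
        Finset.sum_const, Finset.card_univ, Fintype.card_fin, smul_eq_mul]
      rw [mul_comm n, ← mul_add]
      congr 1
      omega
    obtain ⟨a, ha, hak⟩ := e.exists_le_degree_eq k (by omega)
    obtain ⟨b, hb⟩ := exists_add_of_le ha
    have hbk : b.degree = k := by
      rw [hb, map_add] at hdeg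
      omega
    have hS := h _ _ (MvPolynomial.isHomogeneous_monomial 1 hak)
      (MvPolynomial.isHomogeneous_monomial 1 hbk)
    rw [MvPolynomial.monomial_mul, ← hb, one_mul] at hS
    have hA := sum_eval_stdRep (by omega) ⟨m, hm⟩
      (MvPolynomial.isHomogeneous_monomial (1 : F) hdeg)
    have hprod : ∏ j, ∑ x : F, x ^ e j = 0 := by
      rw [hS, neg_zero] at hA
      rw [Finset.prod_univ_sum, Fintype.piFinset_univ, ← hA]
      refine Finset.sum_congr rfl fun v _ => ?_
      rw [MvPolynomial.eval_monomial, one_mul, Finsupp.prod_fintype _ _ (by simp)]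
    obtain ⟨j, -, hj⟩ := Finset.prod_eq_zero_iff.mp hprod
    have hej : e j ≠ 0 ∧ Fintype.card F - 1 ∣ e j := by
      refine Fin.cases ?_ (fun i => ?_) j
      · simp [e]
        omega
      · simp [e]
        omega
    rw [sum_pow_eq_neg_one hej.1 hej.2] at hj
    exact neg_ne_zero.mpr one_ne_zero hj
  · rintro ⟨hle, hdvd⟩ f g hf hg
    have hfg := hf.mul hg
    rw [← two_mul] at hfg
    have hA := sum_eval_stdRep (by omega) hdvd hfg
    rw [MvPolynomial.sum_eval_eq_zero] at hA
    · exact neg_eq_zero.mp hA.symm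
    · refine hfg.totalDegree_le.trans_lt ?_
      rw [Fintype.card_fin, mul_add_one, mul_comm _ n]
      omega
end
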